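/- Let m ≥ 1, w ≥ 1 and y be integers with y ≥ m + w, and let c be the largest integer such that S_c ≤ 2^y. Then c ≥ ⌈(y − m − w + 1)/w⌉. -/

import Mathlib

/-- For integers `m ≥ 1`, `w ≥ 1`, `y ≥ m + w`, if `c` is the largest
integer with `S_c ≤ 2^y` (where `S_c = Σ_{j=0}^{c} C(m,j)·(2^w − 1)^j`), then
`c ≥ ⌈(y − m − w + 1)/w⌉`. -/
theorem stmt1 (m w y c : ℕ) (hm : 1 ≤ m) (hw : 1 ≤ w) (hy : m + w ≤ y)
    (hSc : ∑ j ∈ Finset.range (c + 1), m.choose j * (2 ^ w - 1) ^ j ≤ 2 ^ y)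
    (hmax : ∀ c' : ℕ,
      (∑ j ∈ Finset.range (c' + 1), m.choose j * (2 ^ w - 1) ^ j ≤ 2 ^ y) → c' ≤ c) :
    ⌈(((y : ℚ) - m - w + 1) / w)⌉ ≤ (c : ℤ) := by
  have hk : (y - m) / w * w ≤ y - m := Nat.div_mul_le_self _ _
  have hk2 : y - m < (y - m) / w * w + w := Nat.lt_div_mul_add hw
  generalize (y - m) / w = k at hk hk2
  have hch : ∑ j ∈ Finset.range (k + 1), m.choose j ≤ 2 ^ m := by
    rw [← Nat.sum_range_choose]
    apply Finset.sum_le_sum_of_ne_zero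
    intro j _ hj
    rw [Finset.mem_range]
    by_contra h
    exact hj (Nat.choose_eq_zero_of_lt (by omega))
  have hkc : k ≤ c := by
    apply hmax
    calc ∑ j ∈ Finset.range (k + 1), m.choose j * (2 ^ w - 1) ^ j
        ≤ ∑ j ∈ Finset.range (k + 1), m.choose j * 2 ^ (k * w) := by
          apply Finset.sum_le_sum
          intro j hj
          have hjk : j ≤ k := by
            rw [Finset.mem_range] at hj
            omega
          apply Nat.mul_le_mul_left
          calc (2 ^ w - 1) ^ j ≤ (2 ^ w) ^ j := Nat.pow_le_pow_left (Nat.sub_le _ _) _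
            _ = 2 ^ (j * w) := by rw [← pow_mul, mul_comm]
            _ ≤ 2 ^ (k * w) :=
              Nat.pow_le_pow_right (by norm_num) (Nat.mul_le_mul_right _ hjk)
      _ = (∑ j ∈ Finset.range (k + 1), m.choose j) * 2 ^ (k * w) := by
          rw [Finset.sum_mul]
      _ ≤ 2 ^ m * 2 ^ (k * w) := Nat.mul_le_mul_right _ hch
      _ = 2 ^ (m + k * w) := (pow_add _ _ _).symm
      _ ≤ 2 ^ y := Nat.pow_le_pow_right (by norm_num) (by omega)
  rw [Int.ceil_le]
  have hw' : (0 : ℚ) < w := by exact_mod_cast hw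
  rw [div_le_iff₀ hw']
  have h1 : y + 1 ≤ k * w + w + m := by omega
  have h2 : (y : ℚ) + 1 ≤ k * w + w + m := by exact_mod_cast h1
  have h3 : (k : ℚ) * w ≤ c * w := by exact_mod_cast Nat.mul_le_mul_right w hkc
  push_cast
  linarith
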